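/- Let S be a set of positive integers almost closed under addition, let ε ∈ (0,1), and define the coefficients c_{t,i} as in the context. Then for every integer m ≥ 2 and every r with 1 ≤ r ≤ m, the quantity (m/(2t)) · Σ_{1 ≤ i ≤ t−m+1, i ≡ r (mod m)} c_{t,i} c_{t,i+1} ⋯ c_{t,i+m−1} does not converge to 1 as t → ∞. -/

import Mathlib

open Filter MeasureTheory Finset
open scoped Topology Classical

/-- A basic sequence: a sequence of integers, each at least `2`. -/
def IsBasic (q : ℕ → ℕ) : Prop := ∀ n, 2 ≤ q n

/-- The product `q_0 q_1 ⋯ q_{n-1}` of the first `n` terms of the basic sequence. -/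
def qprod (q : ℕ → ℕ) (n : ℕ) : ℝ := ∏ i ∈ Finset.range n, (q i : ℝ)

/-- `T_{Q,n}(x) = (q_0 q_1 ⋯ q_{n-1}) x mod 1`. -/
noncomputable def TQ (q : ℕ → ℕ) (n : ℕ) (x : ℝ) : ℝ := Int.fract (qprod q n * x)

/-- The `n`-th digit `E_n` of the `Q`-Cantor series expansion of `x`
(digit positions are indexed by `0, 1, 2, …`). -/
noncomputable def qdigit (q : ℕ → ℕ) (x : ℝ) (n : ℕ) : ℕ := ⌊(q n : ℝ) * TQ q n x⌋₊

/-- `N_n^Q(B,x)`: the number of occurrences of the block `B` starting among the first `n`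
digit positions of the `Q`-Cantor series expansion of `x`. -/
noncomputable def blockCount (q : ℕ → ℕ) (x : ℝ) {k : ℕ} (B : Fin k → ℕ) (n : ℕ) : ℕ :=
  ((Finset.range n).filter fun i => ∀ j : Fin k, qdigit q x (i + (j : ℕ)) = B j).card

/-- `Q_n^{(k)} = ∑_{j<n} 1/(q_j q_{j+1} ⋯ q_{j+k-1})`. -/
noncomputable def Qsum (q : ℕ → ℕ) (k n : ℕ) : ℝ :=
  ∑ j ∈ Finset.range n, (∏ i ∈ Finset.range k, (q (j + i) : ℝ))⁻¹

/-- `x` is `Q`-normal of order `k`: every block of length `k` occurs with the expected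
asymptotic frequency. -/
def QNormalOfOrder (q : ℕ → ℕ) (k : ℕ) (x : ℝ) : Prop :=
  ∀ B : Fin k → ℕ,
    Tendsto (fun n => (blockCount q x B n : ℝ) / Qsum q k n) atTop (𝓝 1)

/-- `x ∈ N(Q)`: `x` is `Q`-normal of every order `k ≥ 1`. -/
def QNormal (q : ℕ → ℕ) (x : ℝ) : Prop := ∀ k, 1 ≤ k → QNormalOfOrder q k x

/-- `Q` is fully divergent: `Q_n^{(k)} → ∞` for every `k ≥ 1`. -/
def FullyDivergent (q : ℕ → ℕ) : Prop :=
  ∀ k, 1 ≤ k → Tendsto (fun n => Qsum q k n) atTop atTop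

/-- `Q` is infinite in limit: `q_n → ∞`. -/
def InfiniteInLimit (q : ℕ → ℕ) : Prop := Tendsto q atTop atTop

/-- `N_{n,m,r}^Q(B,x)`: occurrences of the block `B` (of length `m`) starting at
positions `i < n` with `i ≡ r (mod m)`. -/
noncomputable def apCount (q : ℕ → ℕ) (x : ℝ) (m r : ℕ) (B : Fin m → ℕ) (n : ℕ) : ℕ :=
  ((Finset.range n).filter fun i =>
    i % m = r ∧ ∀ j : Fin m, qdigit q x (i + (j : ℕ)) = B j).card

/-- `Q_n^{(m,r)} = ∑_{j=0}^{⌊(n-r)/m⌋} 1/(q_{mj+r} q_{mj+r+1} ⋯ q_{mj+r+m-1})`. -/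
noncomputable def apQsum (q : ℕ → ℕ) (m r n : ℕ) : ℝ :=
  ∑ j ∈ Finset.range ((n - r) / m + 1),
    (∏ i ∈ Finset.range m, (q (m * j + r + i) : ℝ))⁻¹

/-- `x ∈ N^{I}_{m,r}(Q)`. -/
def MemNAPI (q : ℕ → ℕ) (m r : ℕ) (x : ℝ) : Prop :=
  ∀ B : Fin m → ℕ,
    Tendsto (fun n => (apCount q x m r B n : ℝ) / apQsum q m r n) atTop (𝓝 1)

/-- `x ∈ N^{I}_{Ab}(Q)`: `x` is AP `Q`-abnormal of type I. -/
def APAbnormalI (q : ℕ → ℕ) (x : ℝ) : Prop :=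
  ∀ m, 2 ≤ m → ∀ r, r < m → ¬ MemNAPI q m r x

/-- `x ∈ RN^{I}(Q)`. -/
def MemRNI (q : ℕ → ℕ) (x : ℝ) : Prop :=
  ∀ m, 1 ≤ m → ∀ r, r < m → ∀ B₁ B₂ : Fin m → ℕ,
    Tendsto (fun n => (apCount q x m r B₁ n : ℝ) / (apCount q x m r B₂ n : ℝ))
      atTop (𝓝 1)

/-- `Λ_{m,r}(Q) = (q_{mt+r})_t`. -/
def lamQ (q : ℕ → ℕ) (m r : ℕ) : ℕ → ℕ := fun t => q (m * t + r)

/-- `Υ_{Q,m,r}(x)`: the real number whose `Λ_{m,r}(Q)`-Cantor series digits are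
`(E_{mt+r})_t`, where `(E_n)` are the `Q`-Cantor series digits of `x`. -/
noncomputable def Ups (q : ℕ → ℕ) (m r : ℕ) (x : ℝ) : ℝ :=
  ∑' t : ℕ, (qdigit q x (m * t + r) : ℝ) / ∏ i ∈ Finset.range (t + 1), (lamQ q m r i : ℝ)

/-- `x ∈ N^{II}_{k,m,r}(Q) = Υ_{Q,m,r}^{-1}(N_k(Λ_{m,r}(Q)))`. -/
def MemNAPII (q : ℕ → ℕ) (k m r : ℕ) (x : ℝ) : Prop :=
  QNormalOfOrder (lamQ q m r) k (Ups q m r x)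

/-- `x ∈ N^{II}(Q)`: `x` is AP `Q`-normal of type II. -/
def APNormalII (q : ℕ → ℕ) (x : ℝ) : Prop :=
  ∀ k, 1 ≤ k → ∀ m, 1 ≤ m → ∀ r, r < m → MemNAPII q k m r x

/-- `x ∈ RN^{II}(Q)`: for all `k, m, r` the counts in `Υ_{Q,m,r}(x)` of any two blocks of
length `k` with respect to `Λ_{m,r}(Q)` have ratio tending to `1`. -/
def MemRNII (q : ℕ → ℕ) (x : ℝ) : Prop :=
  ∀ k, 1 ≤ k → ∀ m, 1 ≤ m → ∀ r, r < m → ∀ B₁ B₂ : Fin k → ℕ,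
    Tendsto (fun n =>
      (blockCount (lamQ q m r) (Ups q m r x) B₁ n : ℝ) /
      (blockCount (lamQ q m r) (Ups q m r x) B₂ n : ℝ)) atTop (𝓝 1)

/-- `S` (a set of positive integers) is almost closed under addition: for every `k ∈ S`,
the set `{x ∉ S : x + k ∈ S}` has asymptotic density `0`. -/
def AlmostClosed (S : Set ℕ) : Prop :=
  ∀ k ∈ S, Tendsto
    (fun t : ℕ => (((Finset.Icc 1 t).filter fun x => x ∉ S ∧ x + k ∈ S).card : ℝ) / t)
    atTop (𝓝 0)

/-- The sequence `u` of reals is uniformly distributed mod 1. -/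
def UDMod1 (u : ℕ → ℝ) : Prop :=
  ∀ a b : ℝ, 0 ≤ a → a < b → b ≤ 1 →
    Tendsto (fun N => (((Finset.range N).filter fun n => u n ∈ Set.Ico a b).card : ℝ) / N)
      atTop (𝓝 (b - a))

/-- `x ∈ DN(Q)`: `x` is `Q`-distribution normal. -/
def DistNormal (q : ℕ → ℕ) (x : ℝ) : Prop := UDMod1 fun n => TQ q n x

/-- `x ∈ DN_{Ab}(Q)`: `x` is AP `Q`-distribution abnormal. -/
def APDistAbnormal (q : ℕ → ℕ) (x : ℝ) : Prop :=
  ∀ m, 2 ≤ m → ∀ r, r < m → ¬ UDMod1 fun n => TQ q (m * n + r) x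

/-- `y ∈ D_{(x_n)}(Q)`: for every `ξ ∈ (0,1)`, the proportion of `n ≤ N` with
`fract (T_{Q,n}(y) - x_n) < ξ` tends to `1`. -/
def MemD (q : ℕ → ℕ) (xs : ℕ → ℝ) (y : ℝ) : Prop :=
  ∀ ξ : ℝ, 0 < ξ → ξ < 1 →
    Tendsto (fun N =>
      (((Finset.range N).filter fun n => Int.fract (TQ q n y - xs n) < ξ).card : ℝ) / N)
      atTop (𝓝 1)

/-- A computable real number. -/
def ComputableReal (x : ℝ) : Prop :=
  ∃ f : ℕ → ℕ, Computable f ∧ ∀ n : ℕ, 0 < n → (f n : ℝ) / n ≤ x ∧ x ≤ ((f n : ℝ) + 1) / n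

/-- The indicator function `1_{ℕ∖S}` of the complement of `S`, with values in `ℤ`. -/
noncomputable def indZ (S : Set ℕ) (i : ℕ) : ℤ := if i ∈ S then 0 else 1

/-- The indicator function `1_{ℕ∖S}` of the complement of `S`, with values in `ℝ`. -/
noncomputable def indR (S : Set ℕ) (i : ℕ) : ℝ := if i ∈ S then 0 else 1

/-- The coefficients `c_{t,i}`: `c_{t,1} = t (1+ε)^{1_{ℕ∖S}(1)}` and
`c_{t,i} = (1+ε)^{1_{ℕ∖S}(i) - 1_{ℕ∖S}(i-1)}` for `i ≥ 2`. -/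
noncomputable def coeff (S : Set ℕ) (ε : ℝ) (t i : ℕ) : ℝ :=
  if i = 1 then (t : ℝ) * (1 + ε) ^ indZ S 1
  else (1 + ε) ^ (indZ S i - indZ S (i - 1))

/-- `N_k(b)`: the set of real numbers normal of order `k` in base `b`. -/
def BaseNormalOfOrder (b k : ℕ) : Set ℝ :=
  {x | ∀ B : Fin k → ℕ, (∀ j, B j < b) →
    Tendsto (fun n => (blockCount (fun _ => b) x B n : ℝ) / n) atTop
      (𝓝 (((b : ℝ) ^ k)⁻¹))}

/-- Products of consecutive coefficients that avoid the first one telescope. -/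
theorem prod_coeff_of_one_le (S : Set ℕ) {ε : ℝ} (hε : 0 < ε) (t k : ℕ) {i : ℕ} (hi : 1 ≤ i) :
    ∏ j ∈ Finset.range k, coeff S ε t (i + 1 + j) = (1 + ε) ^ (indZ S (i + k) - indZ S i) := by
  have ha : (1 + ε : ℝ) ≠ 0 := by positivity
  induction k with
  | zero => simp
  | succ k ih =>
    have h1 : i + 1 + k ≠ 1 := by omega
    have h2 : i + 1 + k - 1 = i + k := by omega
    have h3 : i + 1 + k = i + (k + 1) := by omega
    rw [Finset.prod_range_succ, ih, coeff, if_neg h1, h2, h3, ← zpow_add₀ ha]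
    congr 1
    ring

/-- The product of the first coefficients. -/
theorem prod_coeff_one (S : Set ℕ) {ε : ℝ} (hε : 0 < ε) (t k : ℕ) :
    ∏ j ∈ Finset.range (k + 1), coeff S ε t (1 + j) = t * (1 + ε) ^ indZ S (k + 1) := by
  have ha : (1 + ε : ℝ) ≠ 0 := by positivity
  induction k with
  | zero => simp [coeff]
  | succ k ih =>
    have h1 : 1 + (k + 1) ≠ 1 := by omega
    have h2 : 1 + (k + 1) - 1 = k + 1 := by omega
    have h3 : 1 + (k + 1) = k + 1 + 1 := by omega
    rw [Finset.prod_range_succ, ih, coeff, if_neg h1, h2, h3, mul_assoc, ← zpow_add₀ ha]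
    congr 2
    ring

theorem indZ_nonneg (S : Set ℕ) (i : ℕ) : 0 ≤ indZ S i := by
  unfold indZ; split_ifs <;> norm_num

theorem indZ_le_one (S : Set ℕ) (i : ℕ) : indZ S i ≤ 1 := by
  unfold indZ; split_ifs <;> norm_num

theorem zpow_indZ_sub_le (S : Set ℕ) {ε : ℝ} (hε : 0 < ε) (i j : ℕ) :
    (1 + ε) ^ (indZ S i - indZ S j) ≤ 1 + ε := by
  have h : indZ S i - indZ S j ≤ 1 := by
    linarith [indZ_le_one S i, indZ_nonneg S j]
  simpa using zpow_le_zpow_right₀ (by linarith : (1 : ℝ) ≤ 1 + ε) h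

theorem inv_le_zpow_indZ_sub (S : Set ℕ) {ε : ℝ} (hε : 0 < ε) (i j : ℕ) :
    (1 + ε)⁻¹ ≤ (1 + ε) ^ (indZ S i - indZ S j) := by
  have h : -1 ≤ indZ S i - indZ S j := by
    linarith [indZ_le_one S j, indZ_nonneg S i]
  simpa using zpow_le_zpow_right₀ (by linarith : (1 : ℝ) ≤ 1 + ε) h

theorem card_filter_mod_le {m r n : ℕ} (hr1 : 1 ≤ r) (hrm : r ≤ m) (hn : 1 ≤ n) :
    ((Finset.Icc 1 (m * n - m + 1)).filter (fun i => i % m = r % m)).card ≤ n := by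
  obtain ⟨k, rfl⟩ : ∃ k, n = k + 1 := ⟨n - 1, by omega⟩
  have hsub : (Finset.Icc 1 (m * (k + 1) - m + 1)).filter (fun i => i % m = r % m) ⊆
      (Finset.range (k + 1)).image (fun j => m * j + r) := by
    intro i hi
    rw [Finset.mem_filter, Finset.mem_Icc, mul_add, mul_one, Nat.add_sub_cancel] at hi
    obtain ⟨⟨h1, h2⟩, h3⟩ := hi
    obtain ⟨i, rfl⟩ : ∃ i', i = i' + 1 := ⟨i - 1, by omega⟩
    obtain ⟨r, rfl⟩ : ∃ r', r = r' + 1 := ⟨r - 1, by omega⟩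
    have h4 : i % m = r := by
      have h : i ≡ r [MOD m] := Nat.ModEq.add_right_cancel' 1 h3
      rwa [Nat.ModEq, Nat.mod_eq_of_lt (by omega : r < m)] at h
    refine Finset.mem_image.2 ⟨i / m, Finset.mem_range.2 ?_, ?_⟩
    · rw [Nat.div_lt_iff_lt_mul (by omega)]
      nlinarith
    · have := Nat.div_add_mod i m
      omega
  simpa using (Finset.card_le_card hsub).trans Finset.card_image_le

/-- If the residue class does not contain `1`, the sum has only telescoped terms. -/
theorem sum_prod_coeff_le (S : Set ℕ) {ε : ℝ} (hε : 0 < ε) {m r n : ℕ} (t : ℕ)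
    (hm : 2 ≤ m) (hr : 2 ≤ r) (hrm : r ≤ m) (hn : 1 ≤ n) :
    ∑ i ∈ (Finset.Icc 1 (m * n - m + 1)).filter (fun i => i % m = r % m),
      ∏ j ∈ Finset.range m, coeff S ε t (i + j) ≤ n * (1 + ε) := by
  have hterm : ∀ i ∈ (Finset.Icc 1 (m * n - m + 1)).filter (fun i => i % m = r % m),
      ∏ j ∈ Finset.range m, coeff S ε t (i + j) ≤ 1 + ε := by
    intro i hi
    rw [Finset.mem_filter, Finset.mem_Icc] at hi
    obtain ⟨⟨h1, -⟩, h3⟩ := hi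
    have hi1 : i ≠ 1 := by
      rintro rfl
      rw [Nat.mod_eq_of_lt (by omega : 1 < m)] at h3
      rcases hrm.lt_or_eq with h | rfl
      · rw [Nat.mod_eq_of_lt h] at h3; omega
      · simp at h3
    obtain ⟨i, rfl⟩ : ∃ i', i = i' + 1 := ⟨i - 1, by omega⟩
    rw [prod_coeff_of_one_le S hε t m (by omega)]
    exact zpow_indZ_sub_le S hε _ _
  refine (Finset.sum_le_card_nsmul _ _ _ hterm).trans ?_
  rw [nsmul_eq_mul]
  gcongr
  exact card_filter_mod_le (by omega) hrm hn

theorem coeff_nonneg (S : Set ℕ) {ε : ℝ} (hε : 0 < ε) (t i : ℕ) : 0 ≤ coeff S ε t i := by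
  unfold coeff; split_ifs <;> positivity

/-- In the residue class of `1`, the first term alone contributes at least `t`. -/
theorem le_sum_prod_coeff (S : Set ℕ) {ε : ℝ} (hε : 0 < ε) {m n : ℕ} (t : ℕ)
    (hm : 2 ≤ m) :
    t + n * (1 + ε)⁻¹ ≤
      ∑ i ∈ (Finset.Icc 1 (m * (n + 1) - m + 1)).filter (fun i => i % m = 1 % m),
        ∏ j ∈ Finset.range m, coeff S ε t (i + j) := by
  have hsub : (Finset.range (n + 1)).image (fun j => m * j + 1) ⊆
      (Finset.Icc 1 (m * (n + 1) - m + 1)).filter (fun i => i % m = 1 % m) := by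
    intro i hi
    obtain ⟨j, hj, rfl⟩ := Finset.mem_image.1 hi
    rw [Finset.mem_range] at hj
    rw [Finset.mem_filter, Finset.mem_Icc, mul_add, mul_one, Nat.add_sub_cancel]
    refine ⟨⟨by omega, ?_⟩, Nat.mul_add_mod _ _ _⟩
    gcongr
    omega
  refine le_trans ?_ (Finset.sum_le_sum_of_subset_of_nonneg hsub
    fun i _ _ => Finset.prod_nonneg fun j _ => coeff_nonneg S hε t _)
  rw [Finset.sum_image (fun x _ y _ h => by
    exact Nat.eq_of_mul_eq_mul_left (by omega : 0 < m) (Nat.add_right_cancel h)),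
    Finset.sum_range_succ', add_comm]
  refine add_le_add ?_ ?_
  · have h := Finset.card_nsmul_le_sum (Finset.range n)
      (fun k => ∏ j ∈ Finset.range m, coeff S ε t (m * (k + 1) + 1 + j)) (1 + ε)⁻¹ (by
        intro k _
        rw [prod_coeff_of_one_le S hε t m (by nlinarith)]
        exact inv_le_zpow_indZ_sub S hε _ _)
    simpa using h
  · obtain ⟨k, rfl⟩ : ∃ k, m = k + 1 := ⟨m - 1, by omega⟩
    rw [mul_zero, zero_add, prod_coeff_one S hε]
    exact le_mul_of_one_le_right (by positivity)
      (one_le_zpow₀ (by linarith) (indZ_nonneg S _))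

/-- For `S` almost closed under addition, `ε ∈ (0,1)`, `m ≥ 2` and `1 ≤ r ≤ m`, the
quantity `(m/(2t)) ∑_{1 ≤ i ≤ t-m+1, i ≡ r (mod m)} c_{t,i} c_{t,i+1} ⋯ c_{t,i+m-1}`
does not converge to `1` as `t → ∞`. -/
theorem stmt10 (S : Set ℕ) (hSpos : 0 ∉ S) (hS : AlmostClosed S)
    (ε : ℝ) (hε : 0 < ε) (hε1 : ε < 1)
    (m : ℕ) (hm : 2 ≤ m) (r : ℕ) (hr1 : 1 ≤ r) (hrm : r ≤ m) :
    ¬ Tendsto (fun t : ℕ =>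
      (m : ℝ) / (2 * (t : ℝ)) *
        ∑ i ∈ (Finset.Icc 1 (t - m + 1)).filter (fun i => i % m = r % m),
          ∏ j ∈ Finset.range m, coeff S ε t (i + j)) atTop (𝓝 1) := by
  intro h
  have hm0 : (0 : ℝ) < m := by exact_mod_cast (by omega : 0 < m)
  have hsubseq : Tendsto (fun n : ℕ => m * (n + 1)) atTop atTop :=
    (tendsto_add_atTop_nat 1).const_mul_atTop' (by omega)
  have hlim := h.comp hsubseq
  rcases hr1.eq_or_lt with rfl | hr2
  · have hbound : 1 + (1 + ε)⁻¹ / 4 ≤ 1 := by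
      refine ge_of_tendsto hlim ?_
      filter_upwards [eventually_ge_atTop 1] with n hn
      have hs := le_sum_prod_coeff S hε (n := n) (m * (n + 1)) hm
      refine le_trans ?_ (mul_le_mul_of_nonneg_left hs (by positivity))
      have hn' : (1 : ℝ) ≤ n := by exact_mod_cast hn
      have hm' : (2 : ℝ) ≤ m := by exact_mod_cast hm
      have hb : 0 < (1 + ε)⁻¹ := by positivity
      push_cast
      rw [show (m : ℝ) / (2 * (m * (n + 1))) * (m * (n + 1) + n * (1 + ε)⁻¹) =
        m / 2 + (1 + ε)⁻¹ * (n / (2 * (n + 1))) by field_simp]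
      have hq : (1 / 4 : ℝ) ≤ n / (2 * (n + 1)) := by
        rw [le_div_iff₀ (by positivity)]; linarith
      nlinarith
    have hb : 0 < (1 + ε)⁻¹ := by positivity
    linarith
  · have hbound : 1 ≤ (1 + ε) / 2 := by
      refine le_of_tendsto hlim (Eventually.of_forall fun n => ?_)
      have hs := sum_prod_coeff_le S hε (n := n + 1) (m * (n + 1)) hm hr2 hrm (by omega)
      refine (mul_le_mul_of_nonneg_left hs (by positivity)).trans_eq ?_
      push_cast
      field_simp
    linarith
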